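/- For every integer t ≥ 2, the number of (5,2)-reverse multiples having exactly t base-5 digits equals 2^{⌊t/2⌋−1}, and there are none with fewer than 2 digits. -/

import Mathlib

/-- `N` is a `(g,k)`-reverse multiple: `N` is positive and reversing its base-`g`
digit list yields the base-`g` expansion of `k * N`. -/
def IsReverseMultiple (g k N : ℕ) : Prop :=
  0 < N ∧ Nat.ofDigits g (Nat.digits g N).reverse = k * N

open Finset

/-- Digitwise doubling in base `5`: if the number with digits `b` is twice the number with digits
`a` plus an incoming carry, then the carries of the long multiplication witness this. -/
theorem exists_carries (t : ℕ) : ∀ (a b : ℕ → ℕ) (r : ℕ), (∀ i, a i < 5) → (∀ i, b i < 5) →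
    r ≤ 1 → ∑ i ∈ range t, b i * 5 ^ i = 2 * ∑ i ∈ range t, a i * 5 ^ i + r →
    ∃ c : ℕ → ℕ, c 0 = r ∧ c t = 0 ∧ (∀ i, c i ≤ 1) ∧
      ∀ i < t, 2 * a i + c i = b i + 5 * c (i + 1) := by
  induction t with
  | zero =>
    intro a b r _ _ hr h
    have hr0 : r = 0 := by simpa using h.symm
    exact ⟨fun _ => 0, hr0.symm, rfl, fun _ => Nat.zero_le _, by simp⟩
  | succ t ih =>
    intro a b r ha hb hr h
    have ha0 := ha 0
    have hb0 := hb 0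
    have shift : ∀ f : ℕ → ℕ, ∑ i ∈ range (t + 1), f i * 5 ^ i
        = 5 * ∑ i ∈ range t, f (i + 1) * 5 ^ i + f 0 := by
      intro f
      rw [sum_range_succ', mul_sum]
      simp only [pow_succ, pow_zero, mul_one]
      congr 1
      exact sum_congr rfl fun i _ => by ring
    rw [shift, shift] at h
    obtain ⟨c, hc0, hct, hc, hstep⟩ := ih (fun i => a (i + 1)) (fun i => b (i + 1))
      ((2 * a 0 + r) / 5) (fun i => ha _) (fun i => hb _) (by omega) (by omega)
    refine ⟨fun i => if i = 0 then r else c (i - 1), by simp, by simpa using hct, ?_, ?_⟩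
    · intro i
      dsimp only
      split_ifs
      exacts [hr, hc _]
    · rintro (_ | i) hi
      · simp only [if_true, zero_add, one_ne_zero, if_false, Nat.sub_self, hc0]
        omega
      · simpa using hstep i (by omega)

/-- If the digits `a` are doubled by reversal, the carries are palindromic and determine `a`. -/
theorem carries_palindromic {t : ℕ} {a c : ℕ → ℕ} (h0 : c 0 = 0) (ht : c t = 0)
    (hc : ∀ i, c i ≤ 1)
    (hstep : ∀ i < t, 2 * a i + c i = a (t - 1 - i) + 5 * c (i + 1)) :
    (∀ i ≤ t, c i = c (t - i)) ∧ ∀ i < t, a i = 3 * c (i + 1) + c i := by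
  have pal : ∀ i ≤ t, c i = c (t - i) := by
    intro i
    induction i with
    | zero => simp [h0, ht]
    | succ i ih =>
      intro hi
      have h1 := hstep i (by omega)
      have h2 := hstep (t - 1 - i) (by omega)
      rw [show t - 1 - (t - 1 - i) = i by omega, show t - 1 - i + 1 = t - i by omega] at h2
      have := ih (by omega)
      rw [show t - (i + 1) = t - 1 - i by omega]
      have := hc (i + 1)
      have := hc (t - 1 - i)
      omega
  refine ⟨pal, fun i hi => ?_⟩
  have h1 := hstep i hi
  have h2 := hstep (t - 1 - i) (by omega)
  rw [show t - 1 - (t - 1 - i) = i by omega, show t - 1 - i + 1 = t - i by omega] at h2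
  have h3 := pal i hi.le
  have h4 := pal (i + 1) hi
  rw [show t - (i + 1) = t - 1 - i by omega] at h4
  omega

theorem ofDigits_map_range (g t : ℕ) (f : ℕ → ℕ) :
    Nat.ofDigits g ((List.range t).map f) = ∑ i ∈ range t, f i * g ^ i := by
  induction t with
  | zero => simp
  | succ t ih =>
    rw [List.range_succ, List.map_append, Nat.ofDigits_append, ih, sum_range_succ]
    simp [mul_comm]

theorem reverse_map_range (t : ℕ) (f : ℕ → ℕ) :
    ((List.range t).map f).reverse = (List.range t).map fun i => f (t - 1 - i) := by
  apply List.ext_getElem <;> simp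

/-- The palindromic carry sequence of length `t + 1` whose first half is the indicator
of `{1} ∪ s`. -/
def carrySeq (t : ℕ) (s : Finset ℕ) (i : ℕ) : ℕ :=
  if min i (t - i) ∈ insert 1 s then 1 else 0

/-- The base-`5` digits determined by the carry sequence. -/
def carryDigits (t : ℕ) (s : Finset ℕ) : List ℕ :=
  (List.range t).map fun i => 3 * carrySeq t s (i + 1) + carrySeq t s i

theorem carrySeq_le_one (t : ℕ) (s : Finset ℕ) (i : ℕ) : carrySeq t s i ≤ 1 := by
  unfold carrySeq
  split_ifs <;> simp

theorem carrySeq_sub {t i : ℕ} (s : Finset ℕ) (hi : i ≤ t) :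
    carrySeq t s (t - i) = carrySeq t s i := by
  unfold carrySeq
  rw [Nat.sub_sub_self hi, min_comm]

theorem carrySeq_zero {t : ℕ} {s : Finset ℕ} (hs : 0 ∉ s) : carrySeq t s 0 = 0 := by
  simp [carrySeq, hs]

theorem carrySeq_one {t : ℕ} (s : Finset ℕ) (ht : 2 ≤ t) : carrySeq t s 1 = 1 := by
  simp [carrySeq, show min 1 (t - 1) = 1 by omega]

theorem digits_ofDigits_carryDigits {t : ℕ} {s : Finset ℕ} (ht : 2 ≤ t) :
    Nat.digits 5 (Nat.ofDigits 5 (carryDigits t s)) = carryDigits t s := by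
  refine Nat.digits_ofDigits 5 (by norm_num) _ ?_ ?_
  · intro d hd
    obtain ⟨i, -, rfl⟩ := List.mem_map.1 hd
    have := carrySeq_le_one t s (i + 1)
    have := carrySeq_le_one t s i
    omega
  · intro h
    have := carrySeq_sub s (show 1 ≤ t by omega)
    rw [carrySeq_one s ht] at this
    simp [carryDigits, List.getLast_eq_getElem, this]

theorem isReverseMultiple_carryDigits {t : ℕ} {s : Finset ℕ} (ht : 2 ≤ t) (hs : 0 ∉ s) :
    IsReverseMultiple 5 2 (Nat.ofDigits 5 (carryDigits t s)) := by
  have hd := digits_ofDigits_carryDigits (s := s) ht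
  constructor
  · rw [Nat.pos_iff_ne_zero]
    intro h
    rw [h] at hd
    have := congrArg List.length hd
    simp [carryDigits] at this
    omega
  rw [hd, carryDigits, reverse_map_range, ofDigits_map_range, ofDigits_map_range]
  have telescope : ∀ n, ∑ i ∈ range n, (3 * carrySeq t s i + carrySeq t s (i + 1)) * 5 ^ i
      + carrySeq t s n * 5 ^ n
      = 2 * ∑ i ∈ range n, (3 * carrySeq t s (i + 1) + carrySeq t s i) * 5 ^ i := by
    intro n
    induction n with
    | zero => simp [carrySeq_zero hs]
    | succ n ih =>
      rw [sum_range_succ, sum_range_succ, mul_add, ← ih]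
      ring
  rw [← telescope t]
  have hct : carrySeq t s t = 0 := by
    simpa [carrySeq_zero hs] using carrySeq_sub s (Nat.zero_le t)
  rw [hct, zero_mul, add_zero]
  refine sum_congr rfl fun i hi => ?_
  have hi := mem_range.1 hi
  have h1 := carrySeq_sub s hi.le
  have h2 := carrySeq_sub s (Nat.succ_le_of_lt hi)
  rw [show t - i.succ = t - 1 - i by omega] at h2
  rw [show t - 1 - i + 1 = t - i by omega, h1, h2]

theorem carryDigits_injOn (t : ℕ) :
    Set.InjOn (carryDigits t) ((Icc 2 (t / 2)).powerset : Finset (Finset ℕ)) := by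
  intro s hs s' hs' h
  have hs := mem_powerset.1 (mem_coe.1 hs)
  have hs' := mem_powerset.1 (mem_coe.1 hs')
  have h0 : 0 ∉ s := fun h => by simpa using hs h
  have h0' : 0 ∉ s' := fun h => by simpa using hs' h
  have heq : ∀ i ≤ t, carrySeq t s i = carrySeq t s' i := by
    intro i
    induction i with
    | zero => simp [carrySeq_zero, h0, h0']
    | succ i ih =>
      intro hi
      have := List.map_inj_left.1 h i (List.mem_range.2 hi)
      have := ih (by omega)
      omega
  ext i
  by_cases hi : i ∈ Icc 2 (t / 2)
  · have hi' := mem_Icc.1 hi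
    have := heq i (by omega)
    unfold carrySeq at this
    rw [show min i (t - i) = i by omega] at this
    simp only [mem_insert, show i ≠ 1 by omega, false_or] at this
    split_ifs at this <;> simp_all
  · exact ⟨fun h => absurd (hs h) hi, fun h => absurd (hs' h) hi⟩

theorem exists_carryDigits {t N : ℕ} (ht : 2 ≤ t) (hN : IsReverseMultiple 5 2 N)
    (hlen : (Nat.digits 5 N).length = t) :
    ∃ s ∈ (Icc 2 (t / 2)).powerset, Nat.ofDigits 5 (carryDigits t s) = N := by
  obtain ⟨hpos, hrev⟩ := hN
  obtain ⟨a, ha⟩ : ∃ a : ℕ → ℕ, a = fun i => (Nat.digits 5 N).getD i 0 := ⟨_, rfl⟩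
  have hdig : Nat.digits 5 N = (List.range t).map a := by
    apply List.ext_getElem
    · simp [hlen]
    · intro i h1 h2
      simp [ha, h1]
  have ha5 : ∀ i, a i < 5 := by
    intro i
    rw [ha]
    simp only [Nat.getD_digits _ _ (show 2 ≤ 5 by norm_num)]
    exact Nat.mod_lt _ (by norm_num)
  have hlast : a (t - 1) ≠ 0 := by
    have := Nat.getLast_digit_ne_zero 5 hpos.ne'
    simpa [hdig, List.getLast_eq_getElem] using this
  have hsum : ∑ i ∈ range t, a i * 5 ^ i = N := by
    rw [← ofDigits_map_range, ← hdig, Nat.ofDigits_digits]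
  rw [hdig, reverse_map_range, ofDigits_map_range] at hrev
  obtain ⟨c, hc0, hct, hc, hstep⟩ := exists_carries t a (fun i => a (t - 1 - i)) 0 ha5
    (fun _ => ha5 _) zero_le_one (by rw [hrev, hsum, add_zero])
  obtain ⟨pal, hac⟩ := carries_palindromic hc0 hct hc hstep
  have hc1 : c 1 = 1 := by
    have h1 := hac (t - 1) (by omega)
    rw [show t - 1 + 1 = t by omega, hct, ← pal 1 (by omega)] at h1
    have := hc 1
    omega
  refine ⟨{i ∈ Icc 2 (t / 2) | c i = 1}, mem_powerset.2 (filter_subset _ _), ?_⟩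
  have hcarry : ∀ i ≤ t, carrySeq t {i ∈ Icc 2 (t / 2) | c i = 1} i = c i := by
    have half : ∀ i ≤ t / 2, carrySeq t {i ∈ Icc 2 (t / 2) | c i = 1} i = c i := by
      intro i hi
      have hci := hc i
      unfold carrySeq
      rw [show min i (t - i) = i by omega]
      simp only [mem_insert, mem_filter, mem_Icc]
      rcases (by omega : i = 0 ∨ i = 1 ∨ 2 ≤ i) with rfl | rfl | h2
      · simp [hc0]
      · simp [hc1]
      · split_ifs <;> omega
    intro i hi
    by_cases h : i ≤ t / 2
    · exact half i h
    · rw [pal i hi, ← carrySeq_sub _ hi]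
      exact half _ (by omega)
  rw [carryDigits, ofDigits_map_range, ← hsum]
  refine sum_congr rfl fun i hi => ?_
  have hi := mem_range.1 hi
  rw [hcarry i hi.le, hcarry (i + 1) hi, hac i hi]

theorem count_reverse_multiples_5_2 (t : ℕ) :
    (2 ≤ t →
      {N : ℕ | IsReverseMultiple 5 2 N ∧ (Nat.digits 5 N).length = t}.ncard
        = 2 ^ (t / 2 - 1)) ∧
    (t < 2 →
      {N : ℕ | IsReverseMultiple 5 2 N ∧ (Nat.digits 5 N).length = t} = ∅) := by
  constructor
  · intro ht
    have himage : {N : ℕ | IsReverseMultiple 5 2 N ∧ (Nat.digits 5 N).length = t}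
        = (fun s => Nat.ofDigits 5 (carryDigits t s)) ''
          ((Icc 2 (t / 2)).powerset : Finset (Finset ℕ)) := by
      ext N
      constructor
      · rintro ⟨hN, hlen⟩
        obtain ⟨s, hs, rfl⟩ := exists_carryDigits ht hN hlen
        exact ⟨s, mem_coe.2 hs, rfl⟩
      · rintro ⟨s, hs, rfl⟩
        have hs := mem_powerset.1 (mem_coe.1 hs)
        refine ⟨isReverseMultiple_carryDigits ht fun h => by simpa using hs h, ?_⟩
        rw [digits_ofDigits_carryDigits ht]
        simp [carryDigits]
    rw [himage, Set.InjOn.ncard_image, Set.ncard_coe_finset, card_powerset, Nat.card_Icc]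
    · congr 1
    · intro s hs s' hs' h
      refine carryDigits_injOn t hs hs' ?_
      have := congrArg (Nat.digits 5) h
      simpa only [digits_ofDigits_carryDigits ht] using this
  · intro ht
    rw [Set.eq_empty_iff_forall_notMem]
    rintro N ⟨⟨hpos, hrev⟩, hlen⟩
    have hN : N < 5 := by
      have := (Nat.digits_length_le_iff (b := 5) (k := 1) (by norm_num) N).1 (by omega)
      simpa using this
    rw [Nat.digits_of_lt 5 N hpos.ne' hN] at hrev
    simp at hrev
    omega
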